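/- Let T > 0, σ_X > 0, σ_Y > 0, γ° > 0. Set k := σ_Y²/σ_X², c2 := (√(1+4k) − 1)/(2k), c1 := (√(1+4k) + 1)/(2k) and d := √(1+4k), and define H(γ) := c1·c2·(1 − (γ/γ°)^d)/(c1 + c2·(γ/γ°)^d) for γ ∈ (0, γ°]. For C¹ functions v6, v8, β1, β2, β3, γ on [0,T], write χ(t) := H(γ(t)) and α3 := β3 + β1·χ, and consider the boundary value problem: v6' = β2² + 2β1β2(1−χ) − β1²(1−χ)² + 2v6·α3²γχ/(σ_X²(1−χ)); v8' = −2β2 − 2(1−2α3)β1(1−χ) − 4β1²χ(1−χ) + v8·α3²γχ/(σ_X²(1−χ)); β1' = (α3γ/(2σ_X²σ_Y²(1−χ)))·[2σ_X²(α3−β1)β1(1−χ) − α3²β1γχ·v8 − 2σ_Y²α3χ(β2 − β1(1−χ−2β2χ))]; β2' = (α3γ/(2σ_X²σ_Y²(1−χ)))·[2σ_X²β1²(1−χ)² + 2σ_Y²α3β2χ²(1−2β2) − α3²γχ(2v6 + β2·v8)]; β3' = (α3γ/(2σ_X²σ_Y²(1−χ)))·[−2σ_X²β1(1−χ)β3 +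 2σ_Y²α3β2χ²(1−2β3) − α3²β3γχ·v8]; γ' = −γ²α3²/σ_Y²; with boundary conditions v6(T) = v8(T) = 0, β1(T) = 1/(2(2−χ(T))), β2(T) = (1−χ(T))/(2(2−χ(T))), β3(T) = 1/2, γ(0) = γ°. Then there exists a constant c > 0, depending only on (σ_X, σ_Y) and not on γ° or T, such that for every T with 0 < T < c/γ° this boundary value problem admits a C¹ solution which in addition satisfies β1(t) + β2(t) + β3(t) = 1 and α3(t) > 0 for all t ∈ [0,T]. -/

import Mathlib

open Set

noncomputable def kPV (σX σY : ℝ) : ℝ := σY^2 / σX^2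

noncomputable def c2PV (σX σY : ℝ) : ℝ :=
  (Real.sqrt (1 + 4 * kPV σX σY) - 1) / (2 * kPV σX σY)

noncomputable def c1PV (σX σY : ℝ) : ℝ :=
  (Real.sqrt (1 + 4 * kPV σX σY) + 1) / (2 * kPV σX σY)

noncomputable def dPV (σX σY : ℝ) : ℝ := Real.sqrt (1 + 4 * kPV σX σY)

/-- The closed-form relationship `χ = H(γ)` between the second-order-belief
weight and the follower's posterior variance in the private-value case. -/
noncomputable def HPV (σX σY γo γ : ℝ) : ℝ :=
  c1PV σX σY * c2PV σX σY * (1 - (γ / γo) ^ dPV σX σY) /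
    (c1PV σX σY + c2PV σX σY * (γ / γo) ^ dPV σX σY)

open Filter Topology in
/-- Shooting: a `C¹` autonomous vector field, along which the coordinate `η` does not increase,
has on every short interval `[0, T]` a solution whose terminal value lies on a given curve `p`,
parametrised by `η`, and whose initial `η`-coordinate is prescribed. -/
theorem exists_forall_lt_solution_terminal_on_curve {E : Type*} [NormedAddCommGroup E]
    [NormedSpace ℝ E] [CompleteSpace E] {f : E → E} {p : ℝ → E} {η : E → ℝ} {s₀ : ℝ} {U : Set E}
    (hf : ContDiffAt ℝ 1 f (p s₀)) (hp : ∀ᶠ s in 𝓝 s₀, ContinuousAt p s)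
    (hη : IsBoundedLinearMap ℝ η) (hηp : ∀ s, η (p s) = s) (hU : U ∈ 𝓝 (p s₀))
    (hneg : ∀ x ∈ U, η (f x) ≤ 0) :
    ∃ c : ℝ, 0 < c ∧ ∀ T : ℝ, 0 < T → T < c → ∃ u : ℝ → E,
      (∀ t ∈ Icc 0 T, HasDerivWithinAt u (f (u t)) (Icc 0 T) t ∧ u t ∈ U) ∧
      η (u 0) = s₀ ∧ u T = p (η (u T)) := by
  obtain ⟨ε, hε, a, r, L, K, hr, hPL⟩ := IsPicardLindelof.of_contDiffAt_one hf
  obtain ⟨α, hα, hαc⟩ := (hPL 0).exists_forall_mem_closedBall_eq_hasDerivWithinAt_continuousOn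
  simp only [zero_sub, zero_add] at hα hαc
  have hD : Metric.closedBall (p s₀) r ×ˢ Icc (-ε) ε ∈ 𝓝 (p s₀, (0 : ℝ)) :=
    prod_mem_nhds (Metric.closedBall_mem_nhds _ hr) (Icc_mem_nhds (by linarith) hε)
  have hα0 : α (p s₀, 0) = p s₀ := (hα _ (Metric.mem_closedBall_self r.2)).1
  have hev : ∀ᶠ y in 𝓝 (p s₀, (0 : ℝ)),
      α y ∈ U ∧ y ∈ Metric.closedBall (p s₀) r ×ˢ Icc (-ε) ε := by
    refine Filter.Eventually.and ?_ hD
    exact (hαc.continuousAt hD).eventually (by rw [hα0]; exact hU)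
  obtain ⟨ρ, hρ, hev⟩ := Metric.eventually_nhds_iff.1 hev
  have hev' : ∀ x t, dist x (p s₀) < ρ → |t| < ρ →
      α (x, t) ∈ U ∧ x ∈ Metric.closedBall (p s₀) r ∧ t ∈ Icc (-ε) ε := fun x t hx ht =>
    hev (y := (x, t)) (by
      rw [Prod.dist_eq]
      exact max_lt hx (by simpa [Real.dist_eq] using ht))
  have hps : ∀ᶠ s in 𝓝 s₀, dist (p s) (p s₀) < ρ :=
    hp.self_of_nhds.eventually (Metric.ball_mem_nhds _ hρ)
  obtain ⟨δ, hδ, hδp⟩ := Metric.eventually_nhds_iff.1 (hp.and hps)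
  have hδp' : ∀ s ∈ Icc (s₀ - δ / 2) s₀, ContinuousAt p s ∧ dist (p s) (p s₀) < ρ := by
    intro s hs
    apply hδp
    rw [Real.dist_eq, abs_lt]
    constructor <;> linarith [hs.1, hs.2]
  have hs1 : s₀ - δ / 2 ∈ Icc (s₀ - δ / 2) s₀ := ⟨le_rfl, by linarith⟩
  have hcurve : ∀ s ∈ Icc (s₀ - δ / 2) s₀, α (p s, 0) = p s ∧
      ∀ t ∈ Icc (-ε) ε, HasDerivWithinAt (fun t => α (p s, t)) (f (α (p s, t))) (Icc (-ε) ε) t :=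
    fun s hs => hα _ (hev' _ 0 (hδp' s hs).2 (by simpa using hρ)).2.1
  have hcont1 : ContinuousAt (fun t => η (α (p (s₀ - δ / 2), t))) 0 := by
    have h := ((hcurve _ hs1).2 0 ⟨by linarith, hε.le⟩).hasDerivAt
      (Icc_mem_nhds (by linarith) hε)
    exact hη.continuous.continuousAt.comp h.continuousAt
  have hlow : ∀ᶠ t in 𝓝 (0 : ℝ), η (α (p (s₀ - δ / 2), t)) < s₀ := by
    refine hcont1.eventually_lt continuousAt_const ?_
    rw [(hcurve _ hs1).1, hηp]
    linarith
  obtain ⟨ρ', hρ', hlow⟩ := Metric.eventually_nhds_iff.1 hlow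
  refine ⟨min ρ ρ', lt_min hρ hρ', fun T hT hTc => ?_⟩
  have hTρ : T < ρ := hTc.trans_le (min_le_left _ _)
  have hTρ' : T < ρ' := hTc.trans_le (min_le_right _ _)
  have hmaps : ∀ t ∈ Icc 0 T, |t - T| < ρ := by
    intro t ht
    rw [abs_lt]
    constructor <;> linarith [ht.1, ht.2]
  have hsol : ∀ s ∈ Icc (s₀ - δ / 2) s₀, ∀ t ∈ Icc 0 T,
      HasDerivWithinAt (fun t => α (p s, t - T)) (f (α (p s, t - T))) (Icc 0 T) t ∧
        α (p s, t - T) ∈ U := by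
    intro s hs t ht
    have hm := fun t ht => hev' (p s) (t - T) (hδp' s hs).2 (hmaps t ht)
    refine ⟨?_, (hm t ht).1⟩
    have h1 := (hcurve s hs).2 (t - T) (hm t ht).2.2
    have h2 : HasDerivWithinAt (fun t => t - T) 1 (Icc 0 T) t :=
      (hasDerivWithinAt_id t _).sub_const T
    simpa [Function.comp_def] using h1.scomp t h2 (fun t ht => (hm t ht).2.2)
  have hcontG : ContinuousOn (fun s => η (α (p s, -T))) (Icc (s₀ - δ / 2) s₀) := by
    have hT' : |(-T)| < ρ := by rwa [abs_neg, abs_of_pos hT]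
    refine hη.continuous.comp_continuousOn (hαc.comp ?_ fun s hs => ?_)
    · exact ContinuousOn.prodMk (fun s hs => (hδp' s hs).1.continuousWithinAt) continuousOn_const
    · exact (hev' _ _ (hδp' s hs).2 hT').2
  have hs0 : s₀ ∈ Icc (s₀ - δ / 2) s₀ := ⟨by linarith, le_rfl⟩
  have hG0 : s₀ ≤ η (α (p s₀, -T)) := by
    have hd : ∀ t ∈ Icc 0 T, HasDerivWithinAt (fun t => η (α (p s₀, t - T)))
        (η (f (α (p s₀, t - T)))) (Icc 0 T) t := fun t ht =>
      hη.toContinuousLinearMap.hasFDerivAt.comp_hasDerivWithinAt t (hsol s₀ hs0 t ht).1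
    have hanti : AntitoneOn (fun t => η (α (p s₀, t - T))) (Icc 0 T) := by
      refine antitoneOn_of_hasDerivWithinAt_nonpos (convex_Icc 0 T)
        (fun t ht => (hd t ht).continuousWithinAt)
        (fun t ht => (hd t (interior_subset ht)).mono interior_subset)
        (fun t ht => hneg _ (hsol s₀ hs0 t (interior_subset ht)).2)
    have h := hanti ⟨le_rfl, hT.le⟩ ⟨hT.le, le_rfl⟩ hT.le
    simpa [hα0, hηp] using h
  have hG1 : η (α (p (s₀ - δ / 2), -T)) ≤ s₀ :=
    (hlow (by simpa [Real.dist_eq, abs_of_pos hT] using hTρ')).le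
  obtain ⟨s, hs, hGs⟩ := intermediate_value_Icc (by linarith : s₀ - δ / 2 ≤ s₀) hcontG ⟨hG1, hG0⟩
  refine ⟨fun t => α (p s, t - T), hsol s hs, by simpa using hGs, ?_⟩
  simp [(hcurve s hs).1, hηp]

theorem kPV_pos {σX σY : ℝ} (hσX : 0 < σX) (hσY : 0 < σY) : 0 < kPV σX σY := by
  unfold kPV; positivity

theorem dPV_sq {σX σY : ℝ} (hσX : 0 < σX) (hσY : 0 < σY) :
    dPV σX σY ^ 2 = 1 + 4 * kPV σX σY :=
  Real.sq_sqrt (by linarith [kPV_pos hσX hσY])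

theorem one_lt_dPV {σX σY : ℝ} (hσX : 0 < σX) (hσY : 0 < σY) : 1 < dPV σX σY :=
  Real.lt_sqrt_of_sq_lt (by linarith [kPV_pos hσX hσY])

theorem c1PV_pos {σX σY : ℝ} (hσX : 0 < σX) (hσY : 0 < σY) : 0 < c1PV σX σY := by
  have hk := kPV_pos hσX hσY
  have hd := one_lt_dPV hσX hσY
  unfold dPV at hd
  unfold c1PV
  positivity

theorem c2PV_pos {σX σY : ℝ} (hσX : 0 < σX) (hσY : 0 < σY) : 0 < c2PV σX σY := by
  have hk := kPV_pos hσX hσY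
  have hd := one_lt_dPV hσX hσY
  unfold dPV at hd
  unfold c2PV
  exact div_pos (by linarith) (by linarith)

theorem HPV_denom_pos {σX σY x : ℝ} (hσX : 0 < σX) (hσY : 0 < σY) (hx : 0 < x) :
    0 < c1PV σX σY + c2PV σX σY * x ^ dPV σX σY := by
  have := c1PV_pos hσX hσY
  have := c2PV_pos hσX hσY
  positivity

theorem HPV_self (σX σY : ℝ) {γo : ℝ} (hγo : γo ≠ 0) : HPV σX σY γo γo = 0 := by
  simp [HPV, div_self hγo]

theorem HPV_mul_left (σX σY : ℝ) {γo : ℝ} (hγo : γo ≠ 0) (g : ℝ) :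
    HPV σX σY γo (γo * g) = HPV σX σY 1 g := by
  simp [HPV, mul_div_cancel_left₀ g hγo]

theorem contDiffAt_HPV {σX σY γo g : ℝ} (hσX : 0 < σX) (hσY : 0 < σY) (hγo : 0 < γo)
    (hg : 0 < g) : ContDiffAt ℝ 1 (HPV σX σY γo) g := by
  have hx : 0 < g / γo := div_pos hg hγo
  have hp : ContDiffAt ℝ 1 (fun x : ℝ => (x / γo) ^ dPV σX σY) g :=
    (contDiffAt_id.div_const γo).rpow_const_of_ne hx.ne'
  exact ContDiffAt.div (by fun_prop) (by fun_prop) (HPV_denom_pos hσX hσY hx).ne'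

/-- The Riccati equation for the second-order-belief weight as a function of `log γ`. -/
theorem hasDerivAt_HPV {σX σY γo g : ℝ} (hσX : 0 < σX) (hσY : 0 < σY) (hγo : 0 < γo)
    (hg : 0 < g) :
    HasDerivAt (HPV σX σY γo)
      (-(1 - HPV σX σY γo g - kPV σX σY * HPV σX σY γo g ^ 2) / g) g := by
  have hx : 0 < g / γo := div_pos hg hγo
  have hk := kPV_pos hσX hσY
  have hd := one_lt_dPV hσX hσY
  have hd2 := dPV_sq hσX hσY
  have hD := HPV_denom_pos hσX hσY hx
  have hq : HasDerivAt (fun x : ℝ => (x / γo) ^ dPV σX σY)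
      (dPV σX σY * (g / γo) ^ dPV σX σY / g) g := by
    have h := ((hasDerivAt_id' g).div_const γo).rpow_const (p := dPV σX σY) (Or.inl hx.ne')
    refine h.congr_deriv ?_
    rw [Real.rpow_sub_one hx.ne']
    field_simp
  have hn := (hq.const_sub 1).const_mul (c1PV σX σY * c2PV σX σY)
  have hm := (hq.const_mul (c2PV σX σY)).const_add (c1PV σX σY)
  refine (hn.div hm hD.ne').congr_deriv ?_
  have hc1 : c1PV σX σY = (dPV σX σY + 1) / (2 * kPV σX σY) := rfl
  have hc2 : c2PV σX σY = (dPV σX σY - 1) / (2 * kPV σX σY) := rfl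
  have hk' : kPV σX σY = (dPV σX σY ^ 2 - 1) / 4 := by linarith
  have hd1 : dPV σX σY - 1 ≠ 0 := by linarith
  have hd1' : dPV σX σY + 1 ≠ 0 := by linarith
  have hd1'' : dPV σX σY ^ 2 - 1 ≠ 0 := by nlinarith
  unfold HPV
  rw [hc1, hc2, hk'] at hD
  rw [hc1, hc2, hk']
  generalize dPV σX σY = d at *
  generalize (g / γo) ^ d = q at *
  have e1 : (d + 1) / (2 * ((d ^ 2 - 1) / 4)) = 2 / (d - 1) := by field_simp; ring
  have e2 : (d - 1) / (2 * ((d ^ 2 - 1) / 4)) = 2 / (d + 1) := by field_simp; ring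
  rw [e1, e2] at hD ⊢
  have hD' : (d + 1) + (d - 1) * q ≠ 0 := by
    intro h0
    apply hD.ne'
    field_simp
    linear_combination 2 * h0
  have e3 : 2 / (d - 1) + 2 / (d + 1) * q = 2 * ((d + 1) + (d - 1) * q) / ((d - 1) * (d + 1)) := by
    field_simp
  rw [e3]
  field_simp
  ring

/-- The leader's weight `α3 = β3 + β1 χ` when `β3 = 1 - β1 - β2`. -/
def reducedAlpha (b e x : ℝ) : ℝ := 1 - b - e + b * x

/-- Right-hand side of the equation for `v8` in the reduced system. -/
noncomputable def reducedV8 (σX w b e g x : ℝ) : ℝ :=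
  -(2 * e) - 2 * (1 - 2 * reducedAlpha b e x) * b * (1 - x) - 4 * b ^ 2 * x * (1 - x)
    + w * reducedAlpha b e x ^ 2 * g * x / (σX ^ 2 * (1 - x))

/-- Right-hand side of the equation for `β1` in the reduced system. -/
noncomputable def reducedB1 (σX σY w b e g x : ℝ) : ℝ :=
  (reducedAlpha b e x * g / (2 * σX ^ 2 * σY ^ 2 * (1 - x))) *
    (2 * σX ^ 2 * (reducedAlpha b e x - b) * b * (1 - x)
      - reducedAlpha b e x ^ 2 * b * g * x * w
      - 2 * σY ^ 2 * reducedAlpha b e x * x * (e - b * (1 - x - 2 * e * x)))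

/-- Right-hand side of the equation for `β2` in the reduced system, where `v6` has been
eliminated through `α3 γ (2 v6 + v8) = 2 σY² (β1 (1 - χ) - β2)`. -/
noncomputable def reducedB2 (σX σY w b e g x : ℝ) : ℝ :=
  (reducedAlpha b e x * g / (2 * σX ^ 2 * σY ^ 2 * (1 - x))) *
    (2 * σX ^ 2 * b ^ 2 * (1 - x) ^ 2
      + 2 * σY ^ 2 * reducedAlpha b e x * e * x ^ 2 * (1 - 2 * e)
      - 2 * σY ^ 2 * reducedAlpha b e x * x * (b * (1 - x) - e)
      - reducedAlpha b e x ^ 2 * g * x * (e - 1) * w)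

/-- Right-hand side of the equation for `γ` in the reduced system. -/
noncomputable def reducedGamma (σY b e g x : ℝ) : ℝ :=
  -g ^ 2 * reducedAlpha b e x ^ 2 / σY ^ 2

/-- Solutions `(v8, β1, β2, γ)` of the boundary value problem obtained by eliminating
`β3` and `v6`. -/
structure IsReducedSolution (σX σY γo T : ℝ) (w b e g : ℝ → ℝ) : Prop where
  hasDeriv_v8 : ∀ t ∈ Icc 0 T, HasDerivWithinAt w
    (reducedV8 σX (w t) (b t) (e t) (g t) (HPV σX σY γo (g t))) (Icc 0 T) t
  hasDeriv_b1 : ∀ t ∈ Icc 0 T, HasDerivWithinAt b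
    (reducedB1 σX σY (w t) (b t) (e t) (g t) (HPV σX σY γo (g t))) (Icc 0 T) t
  hasDeriv_b2 : ∀ t ∈ Icc 0 T, HasDerivWithinAt e
    (reducedB2 σX σY (w t) (b t) (e t) (g t) (HPV σX σY γo (g t))) (Icc 0 T) t
  hasDeriv_gamma : ∀ t ∈ Icc 0 T, HasDerivWithinAt g
    (reducedGamma σY (b t) (e t) (g t) (HPV σX σY γo (g t))) (Icc 0 T) t
  gamma_pos : ∀ t ∈ Icc 0 T, 0 < g t
  chi_lt_one : ∀ t ∈ Icc 0 T, HPV σX σY γo (g t) < 1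
  alpha_pos : ∀ t ∈ Icc 0 T, 0 < reducedAlpha (b t) (e t) (HPV σX σY γo (g t))
  v8_terminal : w T = 0
  b1_terminal : b T = 1 / (2 * (2 - HPV σX σY γo (g T)))
  b2_terminal : e T = (1 - HPV σX σY γo (g T)) / (2 * (2 - HPV σX σY γo (g T)))
  gamma_initial : g 0 = γo

/-- The reduced system is invariant under rescaling time and variance. -/
theorem IsReducedSolution.rescale {σX σY γo T : ℝ} {w b e g : ℝ → ℝ} (hγo : 0 < γo)
    (h : IsReducedSolution σX σY 1 (γo * T) w b e g) :
    IsReducedSolution σX σY γo T (fun t => w (γo * t) / γo) (fun t => b (γo * t))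
      (fun t => e (γo * t)) (fun t => γo * g (γo * t)) := by
  have hm : MapsTo (fun t => γo * t) (Icc 0 T) (Icc 0 (γo * T)) := fun t ht =>
    ⟨mul_nonneg hγo.le ht.1, mul_le_mul_of_nonneg_left ht.2 hγo.le⟩
  have hscale : ∀ {f : ℝ → ℝ} {f' t : ℝ},
      HasDerivWithinAt f f' (Icc 0 (γo * T)) (γo * t) →
      HasDerivWithinAt (fun t => f (γo * t)) (γo * f') (Icc 0 T) t := by
    intro f f' t hf
    have h2 : HasDerivWithinAt (fun t => γo * t) γo (Icc 0 T) t := by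
      simpa using (hasDerivWithinAt_id t _).const_mul γo
    exact hf.scomp t h2 hm
  have hH := HPV_mul_left σX σY hγo.ne'
  constructor
  case hasDeriv_v8 =>
    intro t ht
    refine ((hscale (h.hasDeriv_v8 _ (hm ht))).div_const γo).congr_deriv ?_
    rw [hH]
    unfold reducedV8
    field_simp
  case hasDeriv_b1 =>
    intro t ht
    refine (hscale (h.hasDeriv_b1 _ (hm ht))).congr_deriv ?_
    rw [hH]
    unfold reducedB1
    field_simp
  case hasDeriv_b2 =>
    intro t ht
    refine (hscale (h.hasDeriv_b2 _ (hm ht))).congr_deriv ?_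
    rw [hH]
    unfold reducedB2
    field_simp
  case hasDeriv_gamma =>
    intro t ht
    refine ((hscale (h.hasDeriv_gamma _ (hm ht))).const_mul γo).congr_deriv ?_
    rw [hH]
    unfold reducedGamma
    ring
  case gamma_pos => exact fun t ht => mul_pos hγo (h.gamma_pos _ (hm ht))
  case chi_lt_one => exact fun t ht => by rw [hH]; exact h.chi_lt_one _ (hm ht)
  case alpha_pos => exact fun t ht => by rw [hH]; exact h.alpha_pos _ (hm ht)
  case v8_terminal => simp [h.v8_terminal]
  case b1_terminal => rw [hH]; exact h.b1_terminal
  case b2_terminal => rw [hH]; exact h.b2_terminal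
  case gamma_initial => simp [h.gamma_initial]

open Filter Topology in
/-- The normalised reduced problem is solvable on short horizons. -/
theorem exists_isReducedSolution_one {σX σY : ℝ} (hσX : 0 < σX) (hσY : 0 < σY) :
    ∃ c : ℝ, 0 < c ∧ ∀ T : ℝ, 0 < T → T < c →
      ∃ w b e g : ℝ → ℝ, IsReducedSolution σX σY 1 T w b e g := by
  set H := HPV σX σY 1 with hHdef
  have hH1 : H 1 = 0 := HPV_self σX σY one_ne_zero
  have hHc : ContDiffAt ℝ 1 H 1 := contDiffAt_HPV hσX hσY one_pos one_pos
  let f : ℝ × ℝ × ℝ × ℝ → ℝ × ℝ × ℝ × ℝ := fun u =>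
    (reducedV8 σX u.1 u.2.1 u.2.2.1 u.2.2.2 (H u.2.2.2),
      reducedB1 σX σY u.1 u.2.1 u.2.2.1 u.2.2.2 (H u.2.2.2),
      reducedB2 σX σY u.1 u.2.1 u.2.2.1 u.2.2.2 (H u.2.2.2),
      reducedGamma σY u.2.1 u.2.2.1 u.2.2.2 (H u.2.2.2))
  let p : ℝ → ℝ × ℝ × ℝ × ℝ := fun s =>
    (0, 1 / (2 * (2 - H s)), (1 - H s) / (2 * (2 - H s)), s)
  have hp1 : p 1 = (0, 1 / 4, 1 / 4, 1) := by
    simp only [p, hH1]; norm_num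
  have hHu : ContDiffAt ℝ 1 (fun u : ℝ × ℝ × ℝ × ℝ => H u.2.2.2) (p 1) :=
    ContDiffAt.comp (p 1) (g := H) (by rw [hp1]; exact hHc) (by fun_prop)
  have hHp : H (p 1).2.2.2 = 0 := by rw [hp1]; exact hH1
  have hf : ContDiffAt ℝ 1 f (p 1) := by
    have h2 : (2 * σX ^ 2 * σY ^ 2 * (1 - H (p 1).2.2.2)) ≠ 0 := by rw [hHp]; positivity
    have h3 : (σX ^ 2 * (1 - H (p 1).2.2.2)) ≠ 0 := by rw [hHp]; positivity
    refine ContDiffAt.prodMk ?_ (ContDiffAt.prodMk ?_ (ContDiffAt.prodMk ?_ ?_))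
    · unfold reducedV8 reducedAlpha; fun_prop (disch := assumption)
    · unfold reducedB1 reducedAlpha; fun_prop (disch := assumption)
    · unfold reducedB2 reducedAlpha; fun_prop (disch := assumption)
    · unfold reducedGamma reducedAlpha; fun_prop
  have hp : ∀ᶠ s in 𝓝 (1 : ℝ), ContinuousAt p s := by
    have h2 : ∀ᶠ s in 𝓝 (1 : ℝ), H s < 2 :=
      hHc.continuousAt.eventually_lt continuousAt_const (by rw [hH1]; norm_num)
    filter_upwards [h2, lt_mem_nhds one_pos] with s hs hs0
    have hc : ContinuousAt H s := (contDiffAt_HPV hσX hσY one_pos hs0).continuousAt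
    have hne : 2 * (2 - H s) ≠ 0 := by linarith
    have hden : ContinuousAt (fun s => 2 * (2 - H s)) s := by fun_prop
    exact continuousAt_const.prodMk ((continuousAt_const.div hden hne).prodMk
      (((continuousAt_const.sub hc).div hden hne).prodMk continuousAt_id))
  have hU : {u : ℝ × ℝ × ℝ × ℝ | 0 < u.2.2.2 ∧ H u.2.2.2 < 1 ∧
      0 < reducedAlpha u.2.1 u.2.2.1 (H u.2.2.2)} ∈ 𝓝 (p 1) := by
    have hc := hHu.continuousAt
    refine Filter.Eventually.and ?_ (Filter.Eventually.and ?_ ?_)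
    · exact continuousAt_const.eventually_lt (by fun_prop) (by rw [hp1]; exact one_pos)
    · exact hc.eventually_lt continuousAt_const (by rw [hHp]; exact one_pos)
    · unfold reducedAlpha
      refine continuousAt_const.eventually_lt (by fun_prop) ?_
      rw [hHp, hp1]; norm_num
  have hη : IsBoundedLinearMap ℝ (fun u : ℝ × ℝ × ℝ × ℝ => u.2.2.2) :=
    (ContinuousLinearMap.snd ℝ ℝ ℝ ∘L ContinuousLinearMap.snd ℝ ℝ (ℝ × ℝ) ∘L
      ContinuousLinearMap.snd ℝ ℝ (ℝ × ℝ × ℝ)).isBoundedLinearMap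
  obtain ⟨c, hc, hsol⟩ := exists_forall_lt_solution_terminal_on_curve hf hp hη
    (fun s => rfl) hU (fun u _ => by
      change -u.2.2.2 ^ 2 * _ / _ ≤ 0
      rw [neg_mul, neg_div, neg_nonpos]
      positivity)
  refine ⟨c, hc, fun T hT hTc => ?_⟩
  obtain ⟨u, hu, hu0, huT⟩ := hsol T hT hTc
  refine ⟨fun t => (u t).1, fun t => (u t).2.1, fun t => (u t).2.2.1, fun t => (u t).2.2.2, ?_⟩
  constructor
  case hasDeriv_v8 => exact fun t ht => (hu t ht).1.fst
  case hasDeriv_b1 => exact fun t ht => (hu t ht).1.snd.fst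
  case hasDeriv_b2 => exact fun t ht => (hu t ht).1.snd.snd.fst
  case hasDeriv_gamma => exact fun t ht => (hu t ht).1.snd.snd.snd
  case gamma_pos => exact fun t ht => (hu t ht).2.1
  case chi_lt_one => exact fun t ht => (hu t ht).2.2.1
  case alpha_pos => exact fun t ht => (hu t ht).2.2.2
  case v8_terminal => exact congrArg (fun v => v.1) huT
  case b1_terminal => exact congrArg (fun v => v.2.1) huT
  case b2_terminal => exact congrArg (fun v => v.2.2.1) huT
  case gamma_initial => exact hu0

/-- The coefficient `v6` recovered from the reduced system. -/
noncomputable def reducedV6 (σY w b e g x : ℝ) : ℝ :=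
  (2 * σY ^ 2 * (b * (1 - x) - e) / (reducedAlpha b e x * g) - w) / 2

theorem reducedV6_spec {σY w b e g x : ℝ} (hg : g ≠ 0) (ha : reducedAlpha b e x ≠ 0) :
    reducedAlpha b e x * g * (2 * reducedV6 σY w b e g x + w)
      = 2 * σY ^ 2 * (b * (1 - x) - e) := by
  unfold reducedV6
  field_simp
  ring

/-- The elimination of `v6` is consistent with its own differential equation. -/
theorem reducedV6_deriv_eq {σX σY w b e g x : ℝ} (hσX : σX ≠ 0) (hσY : σY ≠ 0) (hg : g ≠ 0)
    (hx : 1 - x ≠ 0) (ha : reducedAlpha b e x ≠ 0) {dw db de dg dx : ℝ}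
    (hdw : dw = reducedV8 σX w b e g x) (hdb : db = reducedB1 σX σY w b e g x)
    (hde : de = reducedB2 σX σY w b e g x) (hdg : dg = reducedGamma σY b e g x)
    (hdx : dx = -(1 - x - kPV σX σY * x ^ 2) / g * dg) :
    (((2 * σY ^ 2 * ((db * (1 - x) + b * (-dx)) - de)) * (reducedAlpha b e x * g)
        - 2 * σY ^ 2 * (b * (1 - x) - e) *
          ((-db - de + (db * x + b * dx)) * g + reducedAlpha b e x * dg)) /
        (reducedAlpha b e x * g) ^ 2 - dw) / 2 =
      e ^ 2 + 2 * b * e * (1 - x) - b ^ 2 * (1 - x) ^ 2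
        + 2 * reducedV6 σY w b e g x * reducedAlpha b e x ^ 2 * g * x / (σX ^ 2 * (1 - x)) := by
  subst hdx hdw hdb hde hdg
  unfold reducedV6 reducedV8 reducedB1 reducedB2 reducedGamma kPV
  obtain ⟨a, hae⟩ : ∃ a, a = reducedAlpha b e x := ⟨_, rfl⟩
  obtain ⟨y, hy⟩ : ∃ y, y = 1 - x := ⟨_, rfl⟩
  rw [← hae] at ha ⊢
  rw [← hy] at hx ⊢
  unfold reducedAlpha at hae
  obtain rfl : e = 1 - b + b * x - a := by linarith
  obtain rfl : x = 1 - y := by linarith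
  field_simp
  ring

theorem contDiffOn_one_of_hasDerivWithinAt {f f' : ℝ → ℝ} {s : Set ℝ} (hs : UniqueDiffOn ℝ s)
    (hf : ∀ t ∈ s, HasDerivWithinAt f (f' t) s t) (hf' : ContinuousOn f' s) :
    ContDiffOn ℝ 1 f s :=
  (contDiffOn_one_iff_derivWithin hs).2 ⟨fun t ht => (hf t ht).differentiableWithinAt,
    hf'.congr fun t ht => (hf t ht).derivWithin (hs t ht)⟩

/-- Existence of a linear Markov equilibrium in the private-value leadership
model at `r = 0` (Cisternas–Kolb, Theorem 1): for every horizon `T < c/γ°`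
(with `c > 0` depending only on `(σX, σY)`), the boundary value problem for
`(v6, v8, β1, β2, β3, γ)` — with `χ = H(γ)` and `α3 = β3 + β1·χ` — admits a C¹
solution which satisfies `β1 + β2 + β3 = 1` and `α3 > 0`. -/
theorem stmt_1 (σX σY : ℝ) (hσX : 0 < σX) (hσY : 0 < σY) :
    ∃ c : ℝ, 0 < c ∧
      ∀ γo T : ℝ, 0 < γo → 0 < T → T < c / γo →
        ∃ v6 v8 β1 β2 β3 γ χ α3 : ℝ → ℝ,
          (∀ t, χ t = HPV σX σY γo (γ t)) ∧
          (∀ t, α3 t = β3 t + β1 t * χ t) ∧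
          ContDiffOn ℝ 1 v6 (Icc 0 T) ∧ ContDiffOn ℝ 1 v8 (Icc 0 T) ∧
          ContDiffOn ℝ 1 β1 (Icc 0 T) ∧ ContDiffOn ℝ 1 β2 (Icc 0 T) ∧
          ContDiffOn ℝ 1 β3 (Icc 0 T) ∧ ContDiffOn ℝ 1 γ (Icc 0 T) ∧
          (∀ t ∈ Icc (0:ℝ) T, HasDerivWithinAt v6
            ((β2 t)^2 + 2 * β1 t * β2 t * (1 - χ t) - (β1 t)^2 * (1 - χ t)^2
              + 2 * v6 t * (α3 t)^2 * γ t * χ t / (σX^2 * (1 - χ t)))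
            (Icc 0 T) t) ∧
          (∀ t ∈ Icc (0:ℝ) T, HasDerivWithinAt v8
            (-(2 * β2 t) - 2 * (1 - 2 * α3 t) * β1 t * (1 - χ t)
              - 4 * (β1 t)^2 * χ t * (1 - χ t)
              + v8 t * (α3 t)^2 * γ t * χ t / (σX^2 * (1 - χ t)))
            (Icc 0 T) t) ∧
          (∀ t ∈ Icc (0:ℝ) T, HasDerivWithinAt β1
            ((α3 t * γ t / (2 * σX^2 * σY^2 * (1 - χ t))) *
              (2 * σX^2 * (α3 t - β1 t) * β1 t * (1 - χ t)
                - (α3 t)^2 * β1 t * γ t * χ t * v8 t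
                - 2 * σY^2 * α3 t * χ t *
                    (β2 t - β1 t * (1 - χ t - 2 * β2 t * χ t))))
            (Icc 0 T) t) ∧
          (∀ t ∈ Icc (0:ℝ) T, HasDerivWithinAt β2
            ((α3 t * γ t / (2 * σX^2 * σY^2 * (1 - χ t))) *
              (2 * σX^2 * (β1 t)^2 * (1 - χ t)^2
                + 2 * σY^2 * α3 t * β2 t * (χ t)^2 * (1 - 2 * β2 t)
                - (α3 t)^2 * γ t * χ t * (2 * v6 t + β2 t * v8 t)))
            (Icc 0 T) t) ∧
          (∀ t ∈ Icc (0:ℝ) T, HasDerivWithinAt β3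
            ((α3 t * γ t / (2 * σX^2 * σY^2 * (1 - χ t))) *
              (-(2 * σX^2 * β1 t * (1 - χ t) * β3 t)
                + 2 * σY^2 * α3 t * β2 t * (χ t)^2 * (1 - 2 * β3 t)
                - (α3 t)^2 * β3 t * γ t * χ t * v8 t))
            (Icc 0 T) t) ∧
          (∀ t ∈ Icc (0:ℝ) T, HasDerivWithinAt γ
            (-(γ t)^2 * (α3 t)^2 / σY^2) (Icc 0 T) t) ∧
          v6 T = 0 ∧ v8 T = 0 ∧
          β1 T = 1 / (2 * (2 - χ T)) ∧
          β2 T = (1 - χ T) / (2 * (2 - χ T)) ∧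
          β3 T = 1/2 ∧ γ 0 = γo ∧
          (∀ t ∈ Icc (0:ℝ) T, β1 t + β2 t + β3 t = 1 ∧ 0 < α3 t) := by
  obtain ⟨c, hc, hsol⟩ := exists_isReducedSolution_one hσX hσY
  refine ⟨c, hc, fun γo T hγo hT hTc => ?_⟩
  obtain ⟨w₁, b₁, e₁, g₁, h₁⟩ := hsol (γo * T) (mul_pos hγo hT) (by
    rwa [mul_comm, ← lt_div_iff₀ hγo])
  obtain ⟨w, b, e, g, h⟩ : ∃ w b e g, IsReducedSolution σX σY γo T w b e g :=
    ⟨_, _, _, _, h₁.rescale hγo⟩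
  let χ : ℝ → ℝ := fun t => HPV σX σY γo (g t)
  let v6 : ℝ → ℝ := fun t => reducedV6 σY (w t) (b t) (e t) (g t) (χ t)
  let β3 : ℝ → ℝ := fun t => 1 - b t - e t
  let α3 : ℝ → ℝ := fun t => β3 t + b t * χ t
  have hw := h.hasDeriv_v8
  have hb := h.hasDeriv_b1
  have he := h.hasDeriv_b2
  have hg := h.hasDeriv_gamma
  have hχ : ∀ t ∈ Icc 0 T, HasDerivWithinAt χ _ (Icc 0 T) t := fun t ht =>
    (hasDerivAt_HPV hσX hσY hγo (h.gamma_pos t ht)).comp_hasDerivWithinAt t (hg t ht)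
  have hχ1 : ∀ t ∈ Icc 0 T, 1 - χ t ≠ 0 := fun t ht =>
    (sub_pos.2 (h.chi_lt_one t ht)).ne'
  have hα0 : ∀ t ∈ Icc 0 T, reducedAlpha (b t) (e t) (χ t) ≠ 0 := fun t ht =>
    (h.alpha_pos t ht).ne'
  have hspec : ∀ t ∈ Icc 0 T,
      α3 t * g t * (2 * v6 t + w t) = 2 * σY ^ 2 * (b t * (1 - χ t) - e t) := fun t ht =>
    reducedV6_spec (h.gamma_pos t ht).ne' (hα0 t ht)
  have hv6 : ∀ t ∈ Icc 0 T, HasDerivWithinAt v6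
      ((e t)^2 + 2 * b t * e t * (1 - χ t) - (b t)^2 * (1 - χ t)^2
        + 2 * v6 t * (α3 t)^2 * g t * χ t / (σX^2 * (1 - χ t))) (Icc 0 T) t := by
    intro t ht
    have hN := (((hb t ht).mul ((hχ t ht).const_sub 1)).sub (he t ht)).const_mul (2 * σY ^ 2)
    have hD := ((((hb t ht).const_sub 1).sub (he t ht)).add ((hb t ht).mul (hχ t ht))).mul (hg t ht)
    have hne := mul_ne_zero (hα0 t ht) (h.gamma_pos t ht).ne'
    exact (((hN.div hD hne).sub (hw t ht)).div_const 2).congr_deriv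
      (reducedV6_deriv_eq hσX.ne' hσY.ne' (h.gamma_pos t ht).ne' (hχ1 t ht) (hα0 t ht)
        rfl rfl rfl rfl rfl)
  have he' : ∀ t ∈ Icc 0 T, HasDerivWithinAt e
      ((α3 t * g t / (2 * σX^2 * σY^2 * (1 - χ t))) *
        (2 * σX^2 * (b t)^2 * (1 - χ t)^2
          + 2 * σY^2 * α3 t * e t * (χ t)^2 * (1 - 2 * e t)
          - (α3 t)^2 * g t * χ t * (2 * v6 t + e t * w t))) (Icc 0 T) t := by
    intro t ht
    refine (he t ht).congr_deriv ?_
    change (α3 t * g t / (2 * σX^2 * σY^2 * (1 - χ t))) *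
      (2 * σX ^ 2 * b t ^ 2 * (1 - χ t) ^ 2
        + 2 * σY ^ 2 * α3 t * e t * χ t ^ 2 * (1 - 2 * e t)
        - 2 * σY ^ 2 * α3 t * χ t * (b t * (1 - χ t) - e t)
        - α3 t ^ 2 * g t * χ t * (e t - 1) * w t) = _
    congr 1
    linear_combination α3 t * χ t * hspec t ht
  have hβ3 : ∀ t ∈ Icc 0 T, HasDerivWithinAt β3
      ((α3 t * g t / (2 * σX^2 * σY^2 * (1 - χ t))) *
        (-(2 * σX^2 * b t * (1 - χ t) * β3 t)
          + 2 * σY^2 * α3 t * e t * (χ t)^2 * (1 - 2 * β3 t)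
          - (α3 t)^2 * β3 t * g t * χ t * w t)) (Icc 0 T) t := by
    intro t ht
    refine (((hb t ht).const_sub 1).sub (he t ht)).congr_deriv ?_
    unfold reducedB1 reducedB2
    rw [neg_sub_left, ← mul_add, ← mul_neg]
    congr 1
    simp only [β3, α3, χ, reducedAlpha]
    ring
  have cw : ContinuousOn w (Icc 0 T) := fun t ht => (hw t ht).continuousWithinAt
  have cb : ContinuousOn b (Icc 0 T) := fun t ht => (hb t ht).continuousWithinAt
  have ce : ContinuousOn e (Icc 0 T) := fun t ht => (he t ht).continuousWithinAt
  have cg : ContinuousOn g (Icc 0 T) := fun t ht => (hg t ht).continuousWithinAt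
  have cχ : ContinuousOn χ (Icc 0 T) := fun t ht => (hχ t ht).continuousWithinAt
  have cv6 : ContinuousOn v6 (Icc 0 T) := fun t ht => (hv6 t ht).continuousWithinAt
  have cβ3 : ContinuousOn β3 (Icc 0 T) := fun t ht => (hβ3 t ht).continuousWithinAt
  have cα3 : ContinuousOn α3 (Icc 0 T) := cβ3.add (cb.mul cχ)
  have n1 : ∀ t ∈ Icc 0 T, σX ^ 2 * (1 - χ t) ≠ 0 := fun t ht =>
    mul_ne_zero (by positivity) (hχ1 t ht)
  have n2 : ∀ t ∈ Icc 0 T, 2 * σX ^ 2 * σY ^ 2 * (1 - χ t) ≠ 0 := fun t ht =>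
    mul_ne_zero (by positivity) (hχ1 t ht)
  have n3 : ∀ t ∈ Icc 0 T, σY ^ 2 ≠ 0 := fun _ _ => by positivity
  have hu := uniqueDiffOn_Icc hT
  have hTT : T ∈ Icc 0 T := ⟨hT.le, le_rfl⟩
  have hχT : 2 - χ T ≠ 0 := by
    have : χ T < 1 := h.chi_lt_one T hTT
    linarith
  have hbT : b T = 1 / (2 * (2 - χ T)) := h.b1_terminal
  have heT : e T = (1 - χ T) / (2 * (2 - χ T)) := h.b2_terminal
  refine ⟨v6, w, b, e, β3, g, χ, α3, fun _ => rfl, fun _ => rfl,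
    contDiffOn_one_of_hasDerivWithinAt hu hv6 ?_, contDiffOn_one_of_hasDerivWithinAt hu hw ?_,
    contDiffOn_one_of_hasDerivWithinAt hu hb ?_, contDiffOn_one_of_hasDerivWithinAt hu he' ?_,
    contDiffOn_one_of_hasDerivWithinAt hu hβ3 ?_, contDiffOn_one_of_hasDerivWithinAt hu hg ?_,
    hv6, hw, hb, he', hβ3, hg, ?_, h.v8_terminal, hbT, heT, ?_, h.gamma_initial, ?_⟩
  · fun_prop (disch := assumption)
  · change ContinuousOn (fun t => -(2 * e t) - 2 * (1 - 2 * α3 t) * b t * (1 - χ t)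
      - 4 * (b t) ^ 2 * χ t * (1 - χ t)
      + w t * (α3 t) ^ 2 * g t * χ t / (σX ^ 2 * (1 - χ t))) (Icc 0 T)
    fun_prop (disch := assumption)
  · change ContinuousOn (fun t => (α3 t * g t / (2 * σX ^ 2 * σY ^ 2 * (1 - χ t))) *
      (2 * σX ^ 2 * (α3 t - b t) * b t * (1 - χ t) - (α3 t) ^ 2 * b t * g t * χ t * w t
        - 2 * σY ^ 2 * α3 t * χ t * (e t - b t * (1 - χ t - 2 * e t * χ t)))) (Icc 0 T)
    fun_prop (disch := assumption)
  · fun_prop (disch := assumption)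
  · fun_prop (disch := assumption)
  · change ContinuousOn (fun t => -(g t) ^ 2 * (α3 t) ^ 2 / σY ^ 2) (Icc 0 T)
    fun_prop (disch := assumption)
  · have hb0 : b T * (1 - χ T) - e T = 0 := by
      rw [hbT, heT]; ring
    simp [v6, reducedV6, hb0, h.v8_terminal]
  · change 1 - b T - e T = 1 / 2
    rw [hbT, heT]
    field_simp
    ring
  · intro t ht
    exact ⟨by simp only [β3]; ring, h.alpha_pos t ht⟩
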